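/- arXiv:2205.01514 — 6 statements merged into one kernel-verified Lean document; each statement's English description precedes it below -/
import Mathlib

section
/- Let $0 < \theta_\epsilon < \pi/4$ and let $m_{\max}$ be the smallest natural number such that $(2m_{\max}+1)\theta_\epsilon \geq \pi/4$. If $\theta \in [0, \pi/2]$ is such that for every natural number $m \leq m_{\max}$ one has $\sin^2((2m+1)\theta) < 1/2$, then $\theta < \theta_\epsilon$. -/
open Real

theorem half_le_sin_sq_of_mem_Icc {x : ℝ} (h₁ : π / 4 ≤ x) (h₂ : x ≤ 3 * π / 4) :
    1 / 2 ≤ Real.sin x ^ 2 := by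
  have hcos : Real.cos (2 * x) ≤ 0 :=
    Real.cos_nonpos_of_pi_div_two_le_of_le (by linarith) (by linarith)
  rw [Real.sin_sq_eq_half_sub]
  linarith

theorem stmt_0 (θε : ℝ) (hθε0 : 0 < θε) (hθε1 : θε < π / 4)
    (mmax : ℕ) (hmmax : IsLeast {m : ℕ | π / 4 ≤ (2 * (m : ℝ) + 1) * θε} mmax)
    (θ : ℝ) (hθ0 : 0 ≤ θ) (hθ1 : θ ≤ π / 2)
    (h : ∀ m : ℕ, m ≤ mmax → Real.sin ((2 * (m : ℝ) + 1) * θ) ^ 2 < 1 / 2) :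
    θ < θε := by
  classical
  by_contra! hle
  have hmax : π / 4 ≤ (2 * (mmax : ℝ) + 1) * θ :=
    le_trans hmmax.1 (by gcongr)
  have hex : ∃ m : ℕ, π / 4 ≤ (2 * (m : ℝ) + 1) * θ := ⟨mmax, hmax⟩
  obtain ⟨m, hm, hmin⟩ : ∃ m : ℕ, π / 4 ≤ (2 * (m : ℝ) + 1) * θ ∧
      ∀ k < m, ¬ π / 4 ≤ (2 * (k : ℝ) + 1) * θ :=
    ⟨Nat.find hex, Nat.find_spec hex, fun _ hk => Nat.find_min hex hk⟩
  have hm_le : m ≤ mmax := by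
    by_contra! hlt
    exact hmin mmax hlt hmax
  refine (h m hm_le).not_ge (half_le_sin_sq_of_mem_Icc hm ?_)
  cases m with
  | zero =>
    push_cast
    linarith [Real.pi_pos]
  | succ k =>
    have hk := hmin k k.lt_succ_self
    have hθ : θ < π / 4 := by
      have h0 := hmin 0 k.succ_pos
      push_cast at h0
      linarith
    push_cast
    linarith
end

section
/- For an even natural number $N$, $\sum_{k=0}^{N/2} \binom{N}{k} \int_0^{1/2} \theta^k (1-\theta)^{N-k} \, d\theta = \frac{N+2}{2(N+1)} - \left(\frac{1}{2}\right)^{N+1} \sum_{k=0}^{N/2} \sum_{i=0}^{k} \frac{N!}{(k-i)!\,(N-k+i+1)!}$. -/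
open Real Finset

/-- The lower tail of the binomial distribution with parameters `N + 1` and `x`, divided by
`N + 1`, is a primitive of minus the `k`-th Bernstein polynomial of degree `N`. -/
lemma hasDerivAt_sum_binomial_tail (N k : ℕ) (hk : k ≤ N) (x : ℝ) :
    HasDerivAt (fun x : ℝ => ∑ j ∈ Finset.range (k + 1),
        (N.factorial : ℝ) / (j.factorial * (N + 1 - j).factorial) *
          (x ^ j * (1 - x) ^ (N + 1 - j)))
      (-((N.choose k : ℝ) * (x ^ k * (1 - x) ^ (N - k)))) x := by
  have hsub : HasDerivAt (fun x : ℝ => 1 - x) (-1) x := by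
    simpa using (hasDerivAt_id x).const_sub 1
  induction k with
  | zero =>
    have h := (hsub.fun_pow (N + 1)).const_mul ((N.factorial : ℝ) / (N + 1).factorial)
    have hN : (N.factorial : ℝ) ≠ 0 := by positivity
    convert! h using 1
    · simp
    · simp [Nat.factorial_succ]
      field_simp
  | succ k ih =>
    obtain ⟨m, rfl⟩ := Nat.exists_eq_add_of_le hk
    simp_rw [Finset.sum_range_succ _ (k + 1)]
    have h := (((hasDerivAt_id' x).fun_pow (k + 1)).fun_mul (hsub.fun_pow (m + 1))).const_mul
      (((k + 1 + m).factorial : ℝ) / ((k + 1).factorial * (m + 1).factorial))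
    have e₁ : k + 1 + m + 1 - (k + 1) = m + 1 := by omega
    have e₂ : k + 1 + m - k = m + 1 := by omega
    have e₃ : k + 1 + m - (k + 1) = m := by omega
    have ih' := ih (by omega)
    rw [e₂] at ih'
    rw [e₁, e₃]
    convert! ih'.fun_add h using 1
    rw [Nat.cast_choose ℝ hk, Nat.cast_choose ℝ (show k ≤ k + 1 + m by omega), e₂, e₃]
    have hk' : (k.factorial : ℝ) ≠ 0 := by positivity
    have hm' : (m.factorial : ℝ) ≠ 0 := by positivity
    simp only [Nat.factorial_succ k, Nat.factorial_succ m, Nat.add_sub_cancel]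
    push_cast
    field_simp
    ring

lemma choose_mul_integral_pow_mul_one_sub_pow (N k : ℕ) (hk : k ≤ N) (x : ℝ) :
    (N.choose k : ℝ) * ∫ θ in (0 : ℝ)..x, θ ^ k * (1 - θ) ^ (N - k) =
      1 / (N + 1) - ∑ j ∈ Finset.range (k + 1),
        (N.factorial : ℝ) / (j.factorial * (N + 1 - j).factorial) *
          (x ^ j * (1 - x) ^ (N + 1 - j)) := by
  have h := intervalIntegral.integral_eq_sub_of_hasDerivAt (a := 0) (b := x)
    (fun y _ => hasDerivAt_sum_binomial_tail N k hk y)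
    (Continuous.intervalIntegrable (by fun_prop) _ _)
  rw [intervalIntegral.integral_neg, intervalIntegral.integral_const_mul] at h
  have hN : (N.factorial : ℝ) ≠ 0 := by positivity
  have h₀ : ∑ j ∈ Finset.range (k + 1),
      (N.factorial : ℝ) / (j.factorial * (N + 1 - j).factorial) *
        ((0 : ℝ) ^ j * (1 - 0) ^ (N + 1 - j)) = 1 / (N + 1) := by
    rw [Finset.sum_range_succ', Finset.sum_eq_zero (fun j _ => by simp)]
    simp [Nat.factorial_succ]
    field_simp
  linarith

theorem stmt_6 (N : ℕ) (hN : Even N) :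
    ∑ k ∈ Finset.range (N / 2 + 1),
        (N.choose k : ℝ) * ∫ θ in (0 : ℝ)..(1 / 2 : ℝ), θ ^ k * (1 - θ) ^ (N - k) =
      (N + 2) / (2 * (N + 1)) -
        (1 / 2 : ℝ) ^ (N + 1) *
          ∑ k ∈ Finset.range (N / 2 + 1), ∑ i ∈ Finset.range (k + 1),
            (N.factorial : ℝ) / ((k - i).factorial * (N - k + i + 1).factorial) := by
  have key : ∀ k ∈ Finset.range (N / 2 + 1),
      (N.choose k : ℝ) * ∫ θ in (0 : ℝ)..(1 / 2 : ℝ), θ ^ k * (1 - θ) ^ (N - k) =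
        1 / (N + 1) - (1 / 2 : ℝ) ^ (N + 1) * ∑ i ∈ Finset.range (k + 1),
          (N.factorial : ℝ) / ((k - i).factorial * (N - k + i + 1).factorial) := by
    intro k hk
    have hkN : k ≤ N := by
      rw [Finset.mem_range] at hk
      omega
    rw [choose_mul_integral_pow_mul_one_sub_pow N k hkN, ← Finset.sum_range_reflect,
      Finset.mul_sum]
    congr 1
    refine Finset.sum_congr rfl fun i hi => ?_
    rw [Finset.mem_range] at hi
    rw [show k + 1 - 1 - i = k - i by omega, show N + 1 - (k - i) = N - k + i + 1 by omega,
      show (1 - 1 / 2 : ℝ) = 1 / 2 by norm_num, ← pow_add,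
      show k - i + (N - k + i + 1) = N + 1 by omega, mul_comm]
  rw [Finset.sum_congr rfl key, Finset.sum_sub_distrib, ← Finset.mul_sum]
  obtain ⟨m, rfl⟩ := hN
  congr 1
  rw [Finset.sum_const, Finset.card_range, show (m + m) / 2 = m by omega, nsmul_eq_mul]
  push_cast
  field_simp
  ring
end

section
/- For an even positive natural number $N$, $\frac{\sum_{k=0}^{N/2} \binom{N}{k} \int_0^{1/2} \theta^k (1-\theta)^{N-k} d\theta}{\sum_{k=0}^{N/2} \binom{N}{k} \int_0^{1} \theta^k (1-\theta)^{N-k} d\theta} = \frac{1}{2} + \left(\frac{1}{2}\right)^{N+1} \frac{N+1}{N+2} \left(2^N - \binom{N}{N/2}\right)$. -/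
open Real Finset

/-- The derivative of the binomial distribution function with respect to the success
probability. -/
theorem hasDerivAt_sum_choose_mul (N k : ℕ) (hk : k ≤ N) (x : ℝ) :
    HasDerivAt (fun x : ℝ => ∑ j ∈ Finset.range (k + 1),
        ((N + 1).choose j : ℝ) * (x ^ j * (1 - x) ^ (N + 1 - j)))
      (-((N + 1) * (N.choose k * (x ^ k * (1 - x) ^ (N - k))))) x := by
  have hsub : HasDerivAt (fun x : ℝ => 1 - x) (-1) x := (hasDerivAt_id x).const_sub 1
  induction k with
  | zero => simpa using hsub.fun_pow (N + 1)
  | succ k ih =>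
    obtain ⟨d, rfl⟩ := Nat.exists_eq_add_of_le hk
    have hterm := ((hasDerivAt_pow (k + 1) x).fun_mul (hsub.fun_pow (d + 1))).const_mul
      ((k + 1 + d + 1).choose (k + 1) : ℝ)
    have h1 : ((k + 1 + d + 1 : ℕ) : ℝ) * (k + 1 + d).choose k =
        (k + 1 + d + 1).choose (k + 1) * (k + 1 : ℕ) := by
      exact_mod_cast Nat.add_one_mul_choose_eq (k + 1 + d) k
    have h2 : ((k + 1 + d + 1).choose (k + 1) : ℝ) =
        (k + 1 + d).choose k + (k + 1 + d).choose (k + 1) := by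
      exact_mod_cast Nat.choose_succ_succ (k + 1 + d) k
    simp_rw [Finset.sum_range_succ _ (k + 1)]
    have hsum := (ih (by omega)).fun_add hterm
    rw [show k + 1 + d - k = d + 1 by omega] at hsum
    rw [show k + 1 + d + 1 - (k + 1) = d + 1 by omega, show k + 1 + d - (k + 1) = d by omega]
    refine hsum.congr_deriv ?_
    rw [h2] at h1 ⊢
    push_cast at h1 ⊢
    linear_combination (-(x ^ k * (1 - x) ^ (d + 1)) - x ^ (k + 1) * (1 - x) ^ d) * h1

/-- The incomplete beta integral in terms of the binomial distribution function. -/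
theorem choose_mul_integral_pow_mul (N k : ℕ) (hk : k ≤ N) (a : ℝ) :
    (N.choose k : ℝ) * ∫ θ in (0 : ℝ)..a, θ ^ k * (1 - θ) ^ (N - k) =
      (1 - ∑ j ∈ Finset.range (k + 1),
        ((N + 1).choose j : ℝ) * (a ^ j * (1 - a) ^ (N + 1 - j))) / (N + 1) := by
  have h := intervalIntegral.integral_eq_sub_of_hasDerivAt (a := 0) (b := a)
    (fun x _ => hasDerivAt_sum_choose_mul N k hk x)
    (Continuous.intervalIntegrable (by fun_prop) _ _)
  rw [intervalIntegral.integral_neg, intervalIntegral.integral_const_mul,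
    intervalIntegral.integral_const_mul] at h
  have h0 : ∑ j ∈ Finset.range (k + 1),
      ((N + 1).choose j : ℝ) * ((0 : ℝ) ^ j * (1 - 0) ^ (N + 1 - j)) = 1 := by
    rw [Finset.sum_range_succ']
    simp
  rw [h0] at h
  rw [eq_div_iff (by positivity)]
  linear_combination -h

theorem two_mul_sum_sum_choose (N m : ℕ) :
    2 * ∑ k ∈ Finset.range (m + 1), ∑ j ∈ Finset.range (k + 1), ((N + 1).choose j : ℝ) =
      (N + 1) * N.choose m +
        (2 * m + 1 - N) * ∑ j ∈ Finset.range (m + 1), ((N + 1).choose j : ℝ) := by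
  induction m with
  | zero => simp; ring
  | succ m ih =>
    have h1 : ((N : ℝ) + 1) * N.choose m = (N + 1).choose (m + 1) * (m + 1) := by
      exact_mod_cast Nat.add_one_mul_choose_eq N m
    have h2 : ((N + 1).choose (m + 1) : ℝ) = N.choose m + N.choose (m + 1) := by
      exact_mod_cast Nat.choose_succ_succ N m
    rw [Finset.sum_range_succ, mul_add, ih, Finset.sum_range_succ _ (m + 1)]
    push_cast
    linear_combination 2 * h1 + (N + 1) * h2

theorem stmt_11 (N : ℕ) (hN : Even N) (hN0 : 0 < N) :
    (∑ k ∈ Finset.range (N / 2 + 1),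
        (N.choose k : ℝ) * ∫ θ in (0 : ℝ)..(1 / 2 : ℝ), θ ^ k * (1 - θ) ^ (N - k)) /
      (∑ k ∈ Finset.range (N / 2 + 1),
        (N.choose k : ℝ) * ∫ θ in (0 : ℝ)..1, θ ^ k * (1 - θ) ^ (N - k)) =
      1 / 2 + (1 / 2 : ℝ) ^ (N + 1) * ((N + 1) / (N + 2)) *
        (2 ^ N - N.choose (N / 2)) := by
  obtain ⟨n, rfl⟩ := hN.two_dvd
  rw [Nat.mul_div_cancel_left n two_pos]
  have hhalf : ∀ k ∈ Finset.range (n + 1),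
      ((2 * n).choose k : ℝ) * ∫ θ in (0 : ℝ)..(1 / 2 : ℝ), θ ^ k * (1 - θ) ^ (2 * n - k) =
        (1 - (1 / 2) ^ (2 * n + 1) *
          ∑ j ∈ Finset.range (k + 1), ((2 * n + 1).choose j : ℝ)) / (2 * n + 1) := by
    intro k hk
    rw [Finset.mem_range] at hk
    rw [choose_mul_integral_pow_mul _ _ (by omega), Finset.mul_sum]
    push_cast
    congr 2
    refine Finset.sum_congr rfl fun j hj => ?_
    rw [Finset.mem_range] at hj
    rw [show (1 : ℝ) - 1 / 2 = 1 / 2 by norm_num, ← pow_add,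
      Nat.add_sub_cancel' (by omega), mul_comm]
  have hone : ∀ k ∈ Finset.range (n + 1),
      ((2 * n).choose k : ℝ) * ∫ θ in (0 : ℝ)..1, θ ^ k * (1 - θ) ^ (2 * n - k) =
        1 / (2 * n + 1) := by
    intro k hk
    rw [Finset.mem_range] at hk
    rw [choose_mul_integral_pow_mul _ _ (by omega), Finset.sum_eq_zero, sub_zero]
    · push_cast
      rfl
    · intro j hj
      rw [Finset.mem_range] at hj
      rw [sub_self, zero_pow (by omega), mul_zero, mul_zero]
  rw [Finset.sum_congr rfl hhalf, Finset.sum_congr rfl hone, ← Finset.sum_div,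
    Finset.sum_sub_distrib, ← Finset.mul_sum]
  have hT := two_mul_sum_sum_choose (2 * n) n
  have hS : ∑ j ∈ Finset.range (n + 1), ((2 * n + 1).choose j : ℝ) = 4 ^ n := by
    exact_mod_cast Nat.sum_range_choose_halfway n
  rw [hS] at hT
  generalize ∑ k ∈ Finset.range (n + 1), ∑ j ∈ Finset.range (k + 1),
    ((2 * n + 1).choose j : ℝ) = T at hT ⊢
  simp only [Finset.sum_const, Finset.card_range, nsmul_eq_mul]
  push_cast at hT ⊢
  have hpow : (2 : ℝ) ^ (2 * n) = 4 ^ n := by rw [pow_mul]; norm_num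
  have hT' : T = ((2 * n + 1) * (2 * n).choose n + 4 ^ n) / 2 := by linear_combination hT / 2
  rw [hT', one_div_pow, pow_succ, hpow]
  field_simp
  ring
end

section
/- For an even positive natural number $N$, $\frac{1}{2} + \left(\frac{1}{2}\right)^{N+1} \frac{N+1}{N+2} \left(2^N - \binom{N}{N/2}\right) \geq \frac{1}{2} + \frac{N+1}{2(N+2)}\left(1 - \frac{\sqrt{2}}{\sqrt{\pi N}}\right)$. -/
open Real

theorem Real.Wallis.W_mul_centralBinom_sq (m : ℕ) :
    Real.Wallis.W m * ((m.centralBinom : ℝ) ^ 2 * (2 * m + 1)) = 16 ^ m := by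
  have h : (m.centralBinom : ℝ) * (m.factorial : ℝ) ^ 2 = (2 * m).factorial := by
    have h := Nat.choose_mul_factorial_mul_factorial (show m ≤ 2 * m by omega)
    rw [show 2 * m - m = m by omega] at h
    rw [Nat.centralBinom_eq_two_mul_choose, ← h]
    push_cast
    ring
  have hm : (m.factorial : ℝ) ≠ 0 := by positivity
  have hc : (m.centralBinom : ℝ) ≠ 0 := by exact_mod_cast m.centralBinom_ne_zero
  have hl : (2 * m + 1 : ℝ) ≠ 0 := by positivity
  rw [Real.Wallis.W_eq_factorial_ratio, ← h, pow_mul]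
  field_simp
  norm_num

theorem Nat.centralBinom_mul_sqrt_le (m : ℕ) :
    (m.centralBinom : ℝ) * √(π * m) ≤ 4 ^ m := by
  refine le_of_sq_le_sq ?_ (by positivity)
  rw [mul_pow, Real.sq_sqrt (by positivity), ← pow_mul, mul_comm m 2, pow_mul]
  norm_num only
  rw [← Real.Wallis.W_mul_centralBinom_sq m]
  have hW : π * m ≤ Real.Wallis.W m * (2 * m + 1) := by
    calc π * m ≤ (2 * m + 1) / (2 * m + 2) * (π / 2) * (2 * m + 1) := by
          rw [div_mul_eq_mul_div, div_mul_eq_mul_div, le_div_iff₀ (by positivity)]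
          nlinarith [Real.pi_pos]
      _ ≤ _ := by
          gcongr
          exact Real.Wallis.le_W m
  nlinarith [mul_le_mul_of_nonneg_left hW (sq_nonneg (m.centralBinom : ℝ))]

theorem stmt_12 (N : ℕ) (hN : Even N) (hN0 : 0 < N) :
    1 / 2 + (1 / 2 : ℝ) ^ (N + 1) * ((N + 1) / (N + 2)) * (2 ^ N - N.choose (N / 2)) ≥
      1 / 2 + (N + 1) / (2 * (N + 2)) * (1 - Real.sqrt 2 / Real.sqrt (π * N)) := by
  obtain ⟨m, rfl⟩ := hN.two_dvd
  have hm : (0 : ℝ) < m := by exact_mod_cast (show 0 < m by omega)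
  have hsqrt : √2 / √(π * (2 * m : ℕ)) = 1 / √(π * m) := by
    rw [← Real.sqrt_div (by norm_num), ← Real.sqrt_one,
      ← Real.sqrt_div (by norm_num)]
    congr 1
    push_cast
    field_simp
  have hbound : (m.centralBinom : ℝ) / 2 ^ (2 * m) ≤ 1 / √(π * m) := by
    rw [div_le_div_iff₀ (by positivity) (by positivity), pow_mul]
    norm_num only
    simpa using m.centralBinom_mul_sqrt_le
  have hscale : (1 / 2 : ℝ) ^ (2 * m + 1) * (((2 * m : ℕ) + 1) / ((2 * m : ℕ) + 2)) *
        (2 ^ (2 * m) - m.centralBinom) =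
      ((2 * m : ℕ) + 1) / (2 * ((2 * m : ℕ) + 2)) *
        (1 - (m.centralBinom : ℝ) / 2 ^ (2 * m)) := by
    rw [pow_succ, one_div_pow]
    field_simp
  rw [Nat.mul_div_cancel_left m two_pos, ← Nat.centralBinom_eq_two_mul_choose, hscale, hsqrt]
  gcongr
end

section
/- For an even positive natural number $N$, $\frac{1}{2} + \left(\frac{1}{2}\right)^{N+1} \frac{N+1}{N+2} \left(2^N - \binom{N}{N/2}\right) > 1 - \frac{1}{\sqrt{\pi N}}$. -/
open Real

theorem Nat.centralBinom_sq_mul_le (n : ℕ) : n.centralBinom ^ 2 * (3 * n + 1) ≤ (4 ^ n) ^ 2 := by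
  induction n with
  | zero => simp
  | succ n ih =>
    have h := Nat.succ_mul_centralBinom_succ n
    have hpos : 0 < (n + 1) ^ 2 * (3 * n + 1) := by positivity
    refine Nat.le_of_mul_le_mul_left ?_ hpos
    calc (n + 1) ^ 2 * (3 * n + 1) * ((n + 1).centralBinom ^ 2 * (3 * (n + 1) + 1))
        = ((n + 1) * (n + 1).centralBinom) ^ 2 * ((3 * n + 1) * (3 * n + 4)) := by ring
      _ = n.centralBinom ^ 2 * (3 * n + 1) * (4 * (2 * n + 1) ^ 2 * (3 * n + 4)) := by
        rw [h]; ring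
      _ ≤ (4 ^ n) ^ 2 * (16 * ((n + 1) ^ 2 * (3 * n + 1))) := by
        refine Nat.mul_le_mul ih ?_
        nlinarith
      _ = (n + 1) ^ 2 * (3 * n + 1) * (4 ^ (n + 1)) ^ 2 := by ring

theorem Nat.centralBinom_mul_sqrt_le_s13 (n : ℕ) :
    (n.centralBinom : ℝ) * √(3 * n + 1) ≤ 4 ^ n := by
  have h : (n.centralBinom : ℝ) ^ 2 * (3 * n + 1) ≤ (4 ^ n) ^ 2 := by
    exact_mod_cast n.centralBinom_sq_mul_le
  refine le_of_sq_le_sq ?_ (by positivity)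
  rwa [mul_pow, Real.sq_sqrt (by positivity)]

theorem stmt_13 (N : ℕ) (hN : Even N) (hN0 : 0 < N) :
    1 / 2 + (1 / 2 : ℝ) ^ (N + 1) * ((N + 1) / (N + 2)) * (2 ^ N - N.choose (N / 2)) >
      1 - 1 / Real.sqrt (π * N) := by
  obtain ⟨n, rfl⟩ := hN.two_dvd
  have hn : (0 : ℝ) < n := by exact_mod_cast Nat.pos_of_mul_pos_left hN0
  rw [Nat.mul_div_cancel_left n two_pos, ← Nat.centralBinom_eq_two_mul_choose]
  push_cast
  have hc := n.centralBinom_mul_sqrt_le_s13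
  set s := √(3 * (n : ℝ) + 1) with hs
  have hs_pos : 0 < s := by positivity
  have hs_sq : s ^ 2 = 3 * n + 1 := Real.sq_sqrt (by positivity)
  have hy_pos : 0 < √(π * (2 * n)) := by positivity
  have hy : √(π * (2 * n)) ≤ 1.45 * s := by
    refine Real.sqrt_le_iff.mpr ⟨by positivity, ?_⟩
    rw [mul_pow, hs_sq]
    nlinarith [Real.pi_lt_d2]
  set c : ℝ := n.centralBinom / 4 ^ n with hc_def
  have hcs : c ≤ 1 / s := by
    rw [hc_def, div_le_div_iff₀ (by positivity) hs_pos]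
    linarith
  have hmain : (1 + (2 * n + 1) * c) / (2 * n + 2) < 2 / (1.45 * s) := by
    calc (1 + (2 * n + 1) * c) / (2 * n + 2)
        ≤ (1 + (2 * n + 1) * (1 / s)) / (2 * n + 2) := by gcongr
      _ = (s + (2 * n + 1)) / (s * (2 * n + 2)) := by field_simp
      _ < 2 / (1.45 * s) := by
        rw [div_lt_div_iff₀ (by positivity) (by positivity)]
        have : (s + (2 * n + 1)) * 1.45 < 2 * (2 * n + 2) := by
          nlinarith [sq_nonneg (s - 2)]
        nlinarith
  have hle : 2 / (1.45 * s) ≤ 2 / √(π * (2 * n)) := by gcongr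
  have hlhs : 1 / 2 + (1 / 2 : ℝ) ^ (2 * n + 1) * ((2 * n + 1) / (2 * n + 2)) *
      (2 ^ (2 * n) - n.centralBinom) = 1 - (1 + (2 * n + 1) * c) / (2 * n + 2) / 2 := by
    have h4 : (2 : ℝ) ^ (2 * n) = 4 ^ n := by rw [pow_mul]; norm_num
    rw [hc_def, one_div_pow, pow_succ, h4]
    field_simp
    ring
  have htwo : 2 / √(π * (2 * n)) = 2 * (1 / √(π * (2 * n))) := by ring
  rw [hlhs]
  linarith
end

section
/- Let $0 < \delta < 1/2$ and let $N$ be an even positive natural number with $N \geq \frac{1}{\pi \delta^2}$ (in particular, $N = 2\left(\lfloor \frac{1}{\pi\delta^2} \rfloor \,\mathrm{div}\, 2\right) + 2$ works). Then $\frac{1}{2} + \left(\frac{1}{2}\right)^{N+1} \frac{N+1}{N+2}\left(2^N - \binom{N}{N/2}\right) > 1 - \delta$. -/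
open Real

lemma pi_mul_centralBinom_sq_le (m : ℕ) :
    π * m * ((m.centralBinom : ℝ) / 4 ^ m) ^ 2 ≤ 1 := by
  set c : ℝ := (m.centralBinom : ℝ) / 4 ^ m with hc
  have hfact : (m.centralBinom : ℝ) * (m.factorial : ℝ) ^ 2 = ((2 * m).factorial : ℝ) := by
    have h := Nat.choose_mul_factorial_mul_factorial (n := 2 * m) (k := m) (by omega)
    rw [show 2 * m - m = m by omega, ← Nat.centralBinom_eq_two_mul_choose] at h
    rw [← h]
    push_cast
    ring
  have hW : Real.Wallis.W m * (c ^ 2 * (2 * m + 1)) = 1 := by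
    have hf : (m.factorial : ℝ) ≠ 0 := by positivity
    have hb : (m.centralBinom : ℝ) ≠ 0 := by exact_mod_cast m.centralBinom_ne_zero
    rw [Real.Wallis.W_eq_factorial_ratio, ← hfact, hc,
      show (2 : ℝ) ^ (4 * m) = (4 ^ m) ^ 2 by
        rw [pow_mul, pow_right_comm (4 : ℝ)]
        norm_num]
    field_simp
  have hle : ((2 : ℝ) * m + 1) / (2 * m + 2) * (π / 2) * (c ^ 2 * (2 * m + 1)) ≤ 1 := by
    refine le_trans ?_ hW.le
    gcongr
    exact Real.Wallis.le_W m
  have hm : (m : ℝ) ≤ (2 * m + 1) / (2 * m + 2) / 2 * (2 * m + 1) := by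
    rw [div_div, div_mul_eq_mul_div, le_div_iff₀ (by positivity)]
    nlinarith
  calc π * m * c ^ 2 ≤ π * ((2 * m + 1) / (2 * m + 2) / 2 * (2 * m + 1)) * c ^ 2 := by gcongr
    _ ≤ 1 := by linarith

theorem stmt_14 (δ : ℝ) (hδ0 : 0 < δ) (hδ1 : δ < 1 / 2)
    (N : ℕ) (hN : Even N) (hN0 : 0 < N) (hNδ : (N : ℝ) ≥ 1 / (π * δ ^ 2)) :
    1 / 2 + (1 / 2 : ℝ) ^ (N + 1) * ((N + 1) / (N + 2)) * (2 ^ N - N.choose (N / 2)) >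
      1 - δ := by
  obtain ⟨m, rfl⟩ := even_iff_exists_two_mul.mp hN
  have hm : (0 : ℝ) < m := by exact_mod_cast (by omega : 0 < m)
  rw [Nat.mul_div_cancel_left m two_pos, ← Nat.centralBinom_eq_two_mul_choose]
  have hbound := pi_mul_centralBinom_sq_le m
  set c : ℝ := (m.centralBinom : ℝ) / 4 ^ m with hc
  have hmδ : 1 ≤ 2 * m * (π * δ ^ 2) := by
    rw [ge_iff_le, div_le_iff₀ (by positivity)] at hNδ
    push_cast at hNδ
    exact hNδ
  have hcδ : c ≤ 1.415 * δ := by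
    refine le_of_pow_le_pow_left₀ two_ne_zero (by positivity) ?_
    have hsq : c ^ 2 ≤ 2 * δ ^ 2 :=
      le_of_mul_le_mul_left (by linarith) (mul_pos pi_pos hm)
    nlinarith [sq_nonneg δ]
  have hδ : 1 < (1.17 * m + 2.585) * δ := by
    have h1 : 1 ≤ 6.3 * (m * δ ^ 2) := by
      nlinarith [pi_lt_d2, mul_pos hm (pow_pos hδ0 2)]
    refine lt_of_pow_lt_pow_left₀ 2 (by positivity) ?_
    nlinarith [mul_nonneg (sq_nonneg (1.17 * (m : ℝ) - 2.585)) (sq_nonneg δ)]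
  have hform : (1 / 2 : ℝ) ^ (2 * m + 1) * (((2 * m : ℕ) + 1) / ((2 * m : ℕ) + 2)) *
      (2 ^ (2 * m) - m.centralBinom) = (2 * m + 1) * (1 - c) / (2 * (2 * m + 2)) := by
    rw [hc, pow_succ, pow_mul, pow_mul, div_pow, one_pow, div_pow]
    push_cast
    norm_num
    field_simp
  have hkey : (1 - 2 * δ) / 2 < (2 * m + 1) * (1 - c) / (2 * (2 * m + 2)) := by
    rw [lt_div_iff₀ (by positivity)]
    nlinarith
  rw [hform]
  linarith
end
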